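/- Let λ ∈ ℝ, let α > 0, and let Y be a Poisson random variable with parameter α. Then for all real t with 1 + λt > 0 (all t ∈ ℝ when λ = 0), E[e_λ^Y(t)] = e^{α(e_λ(t)−1)}, and for t near 0 this function has Taylor expansion ∑_{n≥0} φ_{n,λ}(α) t^n/n!, where φ_{n,λ} are the degenerate Bell polynomials. -/

import Mathlib

open MeasureTheory Filter Finset Topology

/-- The degenerate falling factorial `(x)_{n,λ} = x(x-λ)(x-2λ)⋯(x-(n-1)λ)`. -/
noncomputable def degFallFac (lam x : ℝ) : ℕ → ℝ
  | 0 => 1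
  | n + 1 => degFallFac lam x n * (x - n * lam)

/-- The degenerate exponential `e_λ^y(t) = (1+λt)^{y/λ}` for `λ ≠ 0`, and `e^{yt}` for `λ = 0`. -/
noncomputable def degExp (lam y t : ℝ) : ℝ :=
  if lam = 0 then Real.exp (y * t) else (1 + lam * t) ^ (y / lam)

/-- The generalized binomial coefficient `C(a,j) = a(a-1)⋯(a-j+1)/j!`. -/
noncomputable def genBinom (a : ℝ) (j : ℕ) : ℝ :=
  (∏ i ∈ Finset.range j, (a - (i : ℝ))) / (j.factorial : ℝ)

/-- The degenerate binomial coefficient `C_λ(x,k) = (x)_{k,λ}/k!`. -/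
noncomputable def degBinom (lam x : ℝ) (k : ℕ) : ℝ :=
  degFallFac lam x k / (k.factorial : ℝ)

open ProbabilityTheory in
/-- A real random variable whose point masses are those of the Poisson distribution follows it. -/
lemma hasLaw_map_cast_poissonMeasure {Ω : Type*} [MeasurableSpace Ω] {μ : Measure Ω}
    [IsProbabilityMeasure μ] {Y : Ω → ℝ} (hY : Measurable Y) (r : NNReal)
    (hlaw : ∀ j : ℕ, μ {ω | Y ω = (j : ℝ)}
      = ENNReal.ofReal (Real.exp (-r) * r ^ j / (j.factorial : ℝ))) :
    HasLaw Y ((poissonMeasure r).map (Nat.cast : ℕ → ℝ)) μ := by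
  have hemb : MeasurableEmbedding (Nat.cast : ℕ → ℝ) := MeasurableEmbedding.natCast
  have hprob : IsProbabilityMeasure (μ.map Y) := Measure.isProbabilityMeasure_map hY.aemeasurable
  have hcomap : (μ.map Y).comap (Nat.cast : ℕ → ℝ) = poissonMeasure r := by
    refine Measure.ext_of_singleton fun j => ?_
    rw [hemb.comap_apply, Set.image_singleton, Measure.map_apply hY (measurableSet_singleton _),
      poissonMeasure_singleton, ← hlaw]
    rfl
  refine ⟨hY.aemeasurable, ?_⟩
  have hle : (poissonMeasure r).map (Nat.cast : ℕ → ℝ) ≤ μ.map Y := by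
    rw [← hcomap, hemb.map_comap]
    exact Measure.restrict_le_self
  exact (Measure.eq_of_le_of_isProbabilityMeasure hle).symm

lemma degExp_natCast {lam t : ℝ} (ht : 0 ≤ 1 + lam * t) (n : ℕ) :
    degExp lam n t = degExp lam 1 t ^ n := by
  unfold degExp
  split_ifs
  · rw [← Real.exp_nat_mul, one_mul]
  · rw [← Real.rpow_natCast, ← Real.rpow_mul ht]
    congr 1
    ring

@[simp]
lemma degExp_zero (lam y : ℝ) : degExp lam y 0 = 1 := by
  simp [degExp]

lemma measurable_degExp (lam t : ℝ) : Measurable fun y => degExp lam y t := by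
  unfold degExp
  split_ifs <;> fun_prop

lemma hasFPowerSeriesAt_zero_of_eventually_hasSum {f : ℝ → ℝ} {a : ℕ → ℝ}
    (h : ∀ᶠ t in 𝓝 (0 : ℝ), HasSum (fun n => a n * t ^ n / (n.factorial : ℝ)) (f t)) :
    HasFPowerSeriesAt f
      (FormalMultilinearSeries.ofScalars ℝ fun n => a n / (n.factorial : ℝ)) 0 := by
  rw [hasFPowerSeriesAt_iff']
  filter_upwards [h] with t ht
  convert! ht using 2 with n
  simp only [FormalMultilinearSeries.coeff_ofScalars, sub_zero, smul_eq_mul]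
  ring

lemma iteratedDeriv_zero_eq_of_eventually_hasSum {f : ℝ → ℝ} {a : ℕ → ℝ}
    (h : ∀ᶠ t in 𝓝 (0 : ℝ), HasSum (fun n => a n * t ^ n / (n.factorial : ℝ)) (f t)) (n : ℕ) :
    iteratedDeriv n f 0 = a n := by
  have hp := hasFPowerSeriesAt_zero_of_eventually_hasSum h
  have heq := congrArg (fun p => p.coeff n)
    (hp.analyticAt.hasFPowerSeriesAt.eq_formalMultilinearSeries hp)
  simp only [FormalMultilinearSeries.coeff_ofScalars] at heq
  exact (div_left_inj' (by positivity)).1 heq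

lemma AnalyticAt.eventually_hasSum_iteratedDeriv_zero {f : ℝ → ℝ} (hf : AnalyticAt ℝ f 0) :
    ∀ᶠ t in 𝓝 (0 : ℝ),
      HasSum (fun n : ℕ => iteratedDeriv n f 0 * t ^ n / (n.factorial : ℝ)) (f t) := by
  filter_upwards [hasFPowerSeriesAt_iff'.1 hf.hasFPowerSeriesAt] with t ht
  convert! ht using 2 with n
  simp only [FormalMultilinearSeries.coeff_ofScalars, sub_zero, smul_eq_mul]
  ring

/-- If `u` vanishes at `0`, then `u ^ n * g` has vanishing derivatives of order `< n` there. -/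
lemma iteratedDeriv_pow_mul_zero {u g : ℝ → ℝ} (hu : AnalyticAt ℝ u 0) (hu0 : u 0 = 0)
    (hg : AnalyticAt ℝ g 0) {i n : ℕ} (hi : i < n) :
    iteratedDeriv i (fun t => u t ^ n * g t) 0 = 0 := by
  have hu1 : ((1 : ℕ) : ℕ∞) ≤ analyticOrderAt u 0 := by
    rw [natCast_le_analyticOrderAt_iff_iteratedDeriv_eq_zero hu]
    intro j hj
    obtain rfl : j = 0 := by lia
    simpa using hu0
  obtain ⟨v, hv, huv⟩ := (natCast_le_analyticOrderAt hu).1 hu1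
  have hf : AnalyticAt ℝ (fun t => u t ^ n * g t) 0 := (hu.fun_pow n).fun_mul hg
  refine (natCast_le_analyticOrderAt_iff_iteratedDeriv_eq_zero hf).1
    ((natCast_le_analyticOrderAt hf).2 ⟨fun t => v t ^ n * g t, (hv.fun_pow n).fun_mul hg, ?_⟩) i hi
  filter_upwards [huv] with t ht
  rw [ht]
  simp only [smul_eq_mul]
  ring

lemma iteratedDeriv_exp_mul_comp_zero {u : ℝ → ℝ} (hu : AnalyticAt ℝ u 0) (hu0 : u 0 = 0)
    (α : ℝ) (n : ℕ) :
    iteratedDeriv n (fun t => Real.exp (α * u t)) 0 =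
      ∑ k ∈ Finset.range (n + 1),
        iteratedDeriv n (fun t => 1 / (k.factorial : ℝ) * u t ^ k) 0 * α ^ k := by
  have hexp : AnalyticAt ℝ (fun z : ℝ => Real.exp (α * z)) 0 := by fun_prop
  obtain ⟨G, hG, hEq⟩ := hexp.exists_eventuallyEq_sum_add_pow_mul (n + 1)
  have hGu : AnalyticAt ℝ (fun t => G (u t)) 0 := AnalyticAt.fun_comp (by rwa [hu0]) hu
  have hterm (k : ℕ) : AnalyticAt ℝ (fun t => 1 / (k.factorial : ℝ) * u t ^ k) 0 := by fun_prop
  have hu_tendsto : Tendsto u (𝓝 0) (𝓝 0) := by simpa [hu0] using hu.continuousAt.tendsto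
  have hEq' : (fun t => Real.exp (α * u t)) =ᶠ[𝓝 0] fun t =>
      (∑ k ∈ Finset.range (n + 1), α ^ k * (1 / (k.factorial : ℝ) * u t ^ k))
        + u t ^ (n + 1) * G (u t) := by
    filter_upwards [hu_tendsto.eventually hEq] with t ht
    rw [ht]
    congr 1
    refine Finset.sum_congr rfl fun k _ => ?_
    rw [iteratedDeriv_exp_const_mul]
    simp only [mul_zero, Real.exp_zero, smul_eq_mul]
    ring
  have hsum : AnalyticAt ℝ (fun t =>
      ∑ k ∈ Finset.range (n + 1), α ^ k * (1 / (k.factorial : ℝ) * u t ^ k)) 0 :=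
    Finset.analyticAt_fun_sum _ fun k _ => analyticAt_const.fun_mul (hterm k)
  rw [hEq'.iteratedDeriv_eq, iteratedDeriv_fun_add hsum.contDiffAt
      ((hu.fun_pow _).fun_mul hGu).contDiffAt,
    iteratedDeriv_pow_mul_zero hu hu0 hGu n.lt_succ_self, add_zero,
    iteratedDeriv_fun_sum fun k _ => (analyticAt_const.fun_mul (hterm k)).contDiffAt]
  refine Finset.sum_congr rfl fun k _ => ?_
  rw [iteratedDeriv_const_mul _ (hterm k).contDiffAt, mul_comm]

/-- **Equation (33).** For `Y` Poisson with parameter `α > 0`: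
`E[e_λ^Y(t)] = e^{α(e_λ(t)-1)}` for all `t` with `1+λt > 0` (all `t ∈ ℝ` when `λ = 0`),
and near `0` this function has the Taylor expansion `∑_{n≥0} φ_{n,λ}(α) t^n/n!`, where
`φ_{n,λ}(y) = ∑_{k=0}^{n} {n brace k}_λ y^k` are the degenerate Bell polynomials. -/
theorem poisson_expectation_degExp_eq_exp_and_bell_expansion
    {Ω : Type*} [MeasurableSpace Ω] (μ : Measure Ω) [IsProbabilityMeasure μ]
    (Y : Ω → ℝ) (hYm : Measurable Y)
    (α : ℝ) (hα : 0 < α)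
    -- `Y` is Poisson with parameter `α`:
    (hlaw : ∀ j : ℕ, μ {ω | Y ω = (j : ℝ)}
      = ENNReal.ofReal (Real.exp (-α) * α ^ j / (j.factorial : ℝ)))
    (lam : ℝ)
    -- degenerate Stirling numbers of the second kind:
    (dSt : ℕ → ℕ → ℝ)
    (hdSt0 : ∀ n k : ℕ, n < k → dSt n k = 0)
    (hdSt : ∀ k : ℕ, ∀ᶠ t in 𝓝 (0 : ℝ),
      HasSum (fun n : ℕ => dSt n k * t ^ n / (n.factorial : ℝ))
        ((1 / (k.factorial : ℝ)) * (degExp lam 1 t - 1) ^ k)) :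
    (∀ t : ℝ, 1 + lam * t > 0 →
      (∫ ω, degExp lam (Y ω) t ∂μ) = Real.exp (α * (degExp lam 1 t - 1))) ∧
    (∀ᶠ t in 𝓝 (0 : ℝ),
      HasSum
        (fun n : ℕ =>
          (∑ k ∈ Finset.range (n + 1), dSt n k * α ^ k) * t ^ n / (n.factorial : ℝ))
        (Real.exp (α * (degExp lam 1 t - 1)))) := by
  refine ⟨fun t ht => ?_, ?_⟩
  · have hY := hasLaw_map_cast_poissonMeasure hYm (NNReal.mk α hα.le) hlaw
    have hint := hY.integral_comp (measurable_degExp lam t).aestronglyMeasurable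
    rw [integral_map Measurable.of_discrete.aemeasurable
      (measurable_degExp lam t).aestronglyMeasurable,
      ProbabilityTheory.integral_poissonMeasure] at hint
    refine hint.trans ?_
    have hexp := (NormedSpace.expSeries_div_hasSum_exp (α * degExp lam 1 t)).mul_left
      (Real.exp (-α))
    rw [← Real.exp_eq_exp_ℝ, ← Real.exp_add] at hexp
    convert! hexp.tsum_eq using 1
    · refine tsum_congr fun n => ?_
      rw [degExp_natCast ht.le, NNReal.coe_mk, smul_eq_mul]
      ring
    · congr 1
      ring
  · have hu : AnalyticAt ℝ (fun t => degExp lam 1 t - 1) 0 := by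
      simpa using (hasFPowerSeriesAt_zero_of_eventually_hasSum (hdSt 1)).analyticAt
    have hexp : AnalyticAt ℝ (fun t => Real.exp (α * (degExp lam 1 t - 1))) 0 :=
      (analyticAt_const.fun_mul hu).rexp
    filter_upwards [hexp.eventually_hasSum_iteratedDeriv_zero] with t ht
    convert! ht using 4 with n
    rw [iteratedDeriv_exp_mul_comp_zero hu (by simp) α n]
    exact Finset.sum_congr rfl fun k _ => by
      rw [iteratedDeriv_zero_eq_of_eventually_hasSum (hdSt k) n]
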